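/- Let q be a prime power, F the finite field with q elements, and n ≥ 1 an integer. Let (A_i)_{i≥1} be an infinite sequence of linear codes over F with strictly increasing lengths N_i = ℓ_i·n, where each A_i is a Cartesian product A_i = C_{i,1} × C_{i,2} × ⋯ × C_{i,ℓ_i} of ℓ_i linear codes, each constituent C_{i,j} being a linear [n, n-1] code over F of length exactly n. Then for any sequence (ω_i)_{i≥1} of nonnegative reals with liminf_i ω_i = ω, one has limsup_{i→∞} (1/N_i)·log_q( |A_i| / |A_i(ω_i)| ) ≤ R_0(ω,n). -/

import Mathlib

open Filter Set

noncomputable section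

/-- `λ_q(ω,n)`. -/
def lambdaQ (q : ℕ) (ω : ℝ) (n : ℕ) : ℝ :=
  ⨅ z : Set.Ioc (0:ℝ) 1,
    (-ω * Real.logb q (z : ℝ) - 1 / n +
      (1 / n) * Real.logb q ((1 + ((q:ℝ) - 1) * (z:ℝ)) ^ n + ((q:ℝ) - 1) * (1 - (z:ℝ)) ^ n))

/-- `R_0(ω,n) = (n-1)/n - λ_q(ω,n)`. -/
def R0 (q : ℕ) (ω : ℝ) (n : ℕ) : ℝ := ((n:ℝ) - 1) / n - lambdaQ q ω n

/-- The second moment of a sum of independent centered variables, over a finite product space. -/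
theorem sum_prod_mul_sq_sum_le {ι : Type*} [Fintype ι] [DecidableEq ι] {X : ι → Type*}
    [∀ i, Fintype (X i)] (p Y : ∀ i, X i → ℝ) (B : ℝ) (hp : ∀ i x, 0 ≤ p i x)
    (hp1 : ∀ i, ∑ x, p i x = 1) (hY : ∀ i, ∑ x, p i x * Y i x = 0)
    (hB : ∀ i x, Y i x ^ 2 ≤ B) :
    ∑ c : ∀ i, X i, (∏ i, p i (c i)) * (∑ i, Y i (c i)) ^ 2 ≤ Fintype.card ι * B := by
  have key : ∀ j k, ∑ c : ∀ i, X i, (∏ i, p i (c i)) * (Y j (c j) * Y k (c k)) =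
      ∏ i, ∑ x, p i x * ((if i = j then Y i x else 1) * (if i = k then Y i x else 1)) := by
    intro j k
    rw [Fintype.prod_sum]
    refine Finset.sum_congr rfl fun c _ => ?_
    simp only [Finset.prod_mul_distrib]
    simp
  have hne : ∀ j k, k ≠ j →
      ∑ c : ∀ i, X i, (∏ i, p i (c i)) * (Y j (c j) * Y k (c k)) = 0 := by
    intro j k hjk
    rw [key]
    refine Finset.prod_eq_zero (Finset.mem_univ j) ?_
    simpa [hjk.symm] using hY j
  have heq : ∀ j, ∑ c : ∀ i, X i, (∏ i, p i (c i)) * (Y j (c j) * Y j (c j)) ≤ B := by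
    intro j
    rw [key, Finset.prod_eq_single j]
    · calc _ ≤ ∑ x, p j x * B := by
            refine Finset.sum_le_sum fun x _ => mul_le_mul_of_nonneg_left ?_ (hp j x)
            simpa [sq] using hB j x
        _ = B := by rw [← Finset.sum_mul, hp1, one_mul]
    · intro i _ hij
      simpa [hij] using hp1 i
    · simp
  calc _ = ∑ j, ∑ k, ∑ c : ∀ i, X i, (∏ i, p i (c i)) * (Y j (c j) * Y k (c k)) := by
        simp_rw [sq, Finset.sum_mul_sum, Finset.mul_sum]
        rw [Finset.sum_comm]
        refine Finset.sum_congr rfl fun j _ => Finset.sum_comm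
    _ = ∑ j, ∑ c : ∀ i, X i, (∏ i, p i (c i)) * (Y j (c j) * Y j (c j)) := by
        refine Finset.sum_congr rfl fun j _ => ?_
        exact Finset.sum_eq_single j (fun k _ hk => hne j k hk) (by simp)
    _ ≤ ∑ _j : ι, B := Finset.sum_le_sum fun j _ => heq j
    _ = _ := by simp

/-- The mean of the total weight `∑ i, w i (c i)` when `c` is drawn with probability
proportional to `z ^ ∑ i, w i (c i)`. -/
def tiltedMean {ι : Type*} [Fintype ι] {X : ι → Type*} [∀ i, Fintype (X i)]
    (w : ∀ i, X i → ℕ) (z : ℝ) : ℝ :=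
  ∑ i, (∑ x, (w i x : ℝ) * z ^ w i x) / ∑ x, z ^ w i x

/-- Chebyshev's inequality for the tilted distribution: half of its mass lies on words whose
weight is within `T` of the mean. -/
theorem prod_sum_le_card_mul_rpow {ι : Type*} [Fintype ι] [DecidableEq ι] {X : ι → Type*}
    [∀ i, Fintype (X i)] [∀ i, Nonempty (X i)] (w : ∀ i, X i → ℕ) (n : ℕ)
    (hw : ∀ i x, w i x ≤ n) {z : ℝ} (hz : 0 < z) (hz1 : z ≤ 1) {T : ℝ} (hT : 0 < T)
    (hTn : 2 * (Fintype.card ι * (n : ℝ) ^ 2) ≤ T ^ 2) :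
    (∏ i, ∑ x, z ^ w i x) / 2 ≤
      (Finset.univ.filter fun c : ∀ i, X i =>
        ((∑ i, w i (c i) : ℕ) : ℝ) ≤ tiltedMean w z + T).card * z ^ (tiltedMean w z - T) := by
  set W : ι → ℝ := fun i => ∑ x, z ^ w i x with hWdef
  set E : ι → ℝ := fun i => (∑ x, (w i x : ℝ) * z ^ w i x) / W i with hE
  have hW : ∀ i, 0 < W i := fun i =>
    Finset.sum_pos (fun x _ => pow_pos hz _) Finset.univ_nonempty
  have hPW : 0 < ∏ i, W i := Finset.prod_pos fun i _ => hW i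
  set m := tiltedMean w z with hm
  have hmE : m = ∑ i, E i := rfl
  let p : ∀ i, X i → ℝ := fun i x => z ^ w i x / W i
  have hp : ∀ i x, 0 ≤ p i x := fun i x => div_nonneg (pow_pos hz _).le (hW i).le
  have hp1 : ∀ i, ∑ x, p i x = 1 := fun i => by
    simp only [p, ← Finset.sum_div]
    exact div_self (hW i).ne'
  have hpE : ∀ i, ∑ x, p i x * w i x = E i := fun i => by
    simp only [p, hE, Finset.sum_div]
    exact Finset.sum_congr rfl fun x _ => by ring
  have hE0 : ∀ i, 0 ≤ E i := fun i => by
    rw [← hpE]; exact Finset.sum_nonneg fun x _ => mul_nonneg (hp i x) (Nat.cast_nonneg _)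
  have hEn : ∀ i, E i ≤ n := fun i => by
    rw [← hpE]
    calc _ ≤ ∑ x, p i x * n := Finset.sum_le_sum fun x _ =>
            mul_le_mul_of_nonneg_left (by exact_mod_cast hw i x) (hp i x)
      _ = n := by rw [← Finset.sum_mul, hp1, one_mul]
  have hvar := sum_prod_mul_sq_sum_le p (fun i x => (w i x : ℝ) - E i) ((n : ℝ) ^ 2) hp hp1
    (fun i => by
      simp only [mul_sub, Finset.sum_sub_distrib, hpE, ← Finset.sum_mul, hp1, one_mul, sub_self])
    (fun i x => by
      have h1 : (w i x : ℝ) ≤ n := by exact_mod_cast hw i x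
      have h2 : (0 : ℝ) ≤ w i x := Nat.cast_nonneg _
      have := hE0 i
      have := hEn i
      exact sq_le_sq' (by linarith) (by linarith))
  let P : (∀ i, X i) → ℝ := fun c => ∏ i, p i (c i)
  have hP0 : ∀ c, 0 ≤ P c := fun c => Finset.prod_nonneg fun i _ => hp i _
  have hP1 : ∑ c, P c = 1 := by
    simp only [P]
    rw [← Fintype.prod_sum]
    simp [hp1]
  let wt : (∀ i, X i) → ℝ := fun c => ((∑ i, w i (c i) : ℕ) : ℝ)
  have hvar' : ∑ c, P c * (wt c - m) ^ 2 ≤ T ^ 2 / 2 := by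
    refine le_trans (le_of_eq ?_) (hvar.trans (by linarith))
    refine Finset.sum_congr rfl fun c _ => ?_
    simp only [P, wt, hmE, Finset.sum_sub_distrib, Nat.cast_sum]
  have hPz : ∀ c, P c = z ^ wt c / ∏ i, W i := fun c => by
    simp only [P, p, wt, Finset.prod_div_distrib, Finset.prod_pow_eq_pow_sum, Real.rpow_natCast]
  have hpt : ∀ c, P c ≤ (if wt c ≤ m + T then z ^ (m - T) / ∏ i, W i else 0)
      + P c * (wt c - m) ^ 2 / T ^ 2 := by
    intro c
    by_cases h : |wt c - m| ≤ T
    · obtain ⟨h1, h2⟩ := abs_le.1 h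
      rw [if_pos (by linarith)]
      have h3 : P c ≤ z ^ (m - T) / ∏ i, W i := by
        rw [hPz]
        exact div_le_div_of_nonneg_right
          (Real.rpow_le_rpow_of_exponent_ge hz hz1 (by linarith)) hPW.le
      have h4 : 0 ≤ P c * (wt c - m) ^ 2 / T ^ 2 := 
        div_nonneg (mul_nonneg (hP0 c) (sq_nonneg _)) (sq_nonneg T)
      linarith
    · have h5 : T ^ 2 ≤ (wt c - m) ^ 2 := by
        rw [← sq_abs (wt c - m)]
        exact pow_le_pow_left₀ hT.le (not_le.1 h).le 2
      have h6 : P c ≤ P c * (wt c - m) ^ 2 / T ^ 2 := by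
        rw [le_div_iff₀ (pow_pos hT 2)]
        exact mul_le_mul_of_nonneg_left h5 (hP0 c)
      have h7 : 0 ≤ (if wt c ≤ m + T then z ^ (m - T) / ∏ i, W i else 0) := by
        split_ifs
        · exact div_nonneg (Real.rpow_nonneg hz.le _) hPW.le
        · exact le_rfl
      linarith
  have hsum := Finset.sum_le_sum fun c (_ : c ∈ Finset.univ) => hpt c
  rw [hP1, Finset.sum_add_distrib, ← Finset.sum_div, ← Finset.sum_filter, Finset.sum_const,
    nsmul_eq_mul] at hsum
  have h8 : (∑ c, P c * (wt c - m) ^ 2) / T ^ 2 ≤ 1 / 2 := by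
    rw [div_le_iff₀ (pow_pos hT 2)]; linarith
  have h9 : (1 : ℝ) / 2 ≤ (Finset.univ.filter fun c => wt c ≤ m + T).card *
      (z ^ (m - T) / ∏ i, W i) := by linarith
  rw [← mul_div_assoc, le_div_iff₀ hPW] at h9
  linarith

theorem exists_tiltedMean_eq {ι : Type*} [Fintype ι] {X : ι → Type*}
    [∀ i, Fintype (X i)] (w : ∀ i, X i → ℕ) (x₀ : ∀ i, X i) (hx₀ : ∀ i, w i (x₀ i) = 0)
    {a : ℝ} (ha : 0 < a) :
    ∃ z : ℝ, 0 < z ∧ z ≤ 1 ∧ tiltedMean w z ≤ a ∧ (tiltedMean w z = a ∨ z = 1) := by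
  rcases le_total (tiltedMean w 1) a with h | h
  · exact ⟨1, one_pos, le_rfl, h, Or.inr rfl⟩
  have hpos : ∀ z : ℝ, 0 ≤ z → ∀ i, 0 < ∑ x, z ^ w i x := fun z hz i =>
    Finset.sum_pos' (fun x _ => pow_nonneg hz _)
      ⟨x₀ i, Finset.mem_univ _, by rw [hx₀, pow_zero]; exact one_pos⟩
  have hcont : ContinuousOn (tiltedMean w) (Icc 0 1) := by
    unfold tiltedMean
    refine continuousOn_finsetSum _ fun i _ => ContinuousOn.div ?_ ?_ ?_
    · fun_prop
    · fun_prop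
    · exact fun z hz => (hpos z hz.1 i).ne'
  have h0 : tiltedMean w 0 = 0 := by
    unfold tiltedMean
    refine Finset.sum_eq_zero fun i _ => ?_
    rw [Finset.sum_eq_zero, zero_div]
    intro x _
    rcases Nat.eq_zero_or_pos (w i x) with h | h
    · simp [h]
    · simp [h.ne']
  obtain ⟨z, hz, hza⟩ := intermediate_value_Icc zero_le_one hcont ⟨h0.le.trans ha.le, h⟩
  refine ⟨z, lt_of_le_of_ne hz.1 ?_, hz.2, hza.le, Or.inl hza⟩
  rintro rfl
  exact ha.ne (h0.symm.trans hza)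

/-- The Hamming weight enumerator, at `z`, of the affine hyperplane `∑ t, a t * x t = v`. -/
def cosetEnumerator {K : Type*} [Field K] [Fintype K] [DecidableEq K] {n : ℕ}
    (a : Fin n → K) (z : ℝ) (v : K) : ℝ :=
  ∑ x : Fin n → K, if ∑ t, a t * x t = v then z ^ hammingNorm x else 0

theorem hammingNorm_cons {K : Type*} [Zero K] [DecidableEq K] {n : ℕ} (y : K) (x : Fin n → K) :
    hammingNorm (Fin.cons y x : Fin (n + 1) → K) = (if y = 0 then 0 else 1) + hammingNorm x := by
  simp only [hammingNorm, Finset.card_filter, Fin.sum_univ_succ, Fin.cons_zero, Fin.cons_succ]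
  congr 1
  split_ifs <;> simp_all

theorem cosetEnumerator_succ {K : Type*} [Field K] [Fintype K] [DecidableEq K] {n : ℕ}
    (a : Fin (n + 1) → K) (z : ℝ) (v : K) :
    cosetEnumerator a z v = (1 - z) * cosetEnumerator (Fin.tail a) z v +
      z * ∑ y, cosetEnumerator (Fin.tail a) z (v - a 0 * y) := by
  have h : cosetEnumerator a z v = ∑ y, (if y = 0 then 1 else z) *
      cosetEnumerator (Fin.tail a) z (v - a 0 * y) := by
    unfold cosetEnumerator
    rw [← (Fin.consEquiv fun _ => K).sum_comp, Fintype.sum_prod_type]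
    refine Finset.sum_congr rfl fun y _ => ?_
    rw [Finset.mul_sum]
    refine Finset.sum_congr rfl fun x _ => ?_
    have hnorm : hammingNorm ((Fin.consEquiv fun _ => K) (y, x)) =
        (if y = 0 then 0 else 1) + hammingNorm x := hammingNorm_cons y x
    rw [hnorm]
    simp only [Fin.consEquiv_apply, Fin.sum_univ_succ, Fin.cons_zero, Fin.cons_succ,
      Fin.tail, eq_sub_iff_add_eq', pow_add]
    split_ifs <;> simp
  have h2 : ∀ y : K, (if y = 0 then (1 : ℝ) else z) = (if y = 0 then 1 - z else 0) + z := by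
    intro y; split_ifs <;> ring
  simp only [h, h2, add_mul, Finset.sum_add_distrib, ite_mul, zero_mul, Finset.sum_ite_eq',
    Finset.mem_univ, if_true, Finset.mul_sum, mul_zero, sub_zero]

theorem sum_cosetEnumerator {K : Type*} [Field K] [Fintype K] [DecidableEq K] {n : ℕ}
    (a : Fin n → K) (z : ℝ) :
    ∑ v, cosetEnumerator a z v = (1 + ((Fintype.card K : ℝ) - 1) * z) ^ n := by
  induction n with
  | zero => simp [cosetEnumerator, hammingNorm]
  | succ n ih =>
    have h : ∀ y, ∑ v, cosetEnumerator (Fin.tail a) z (v - a 0 * y) =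
        ∑ v, cosetEnumerator (Fin.tail a) z v := fun y =>
      (Equiv.subRight (a 0 * y)).sum_comp (cosetEnumerator (Fin.tail a) z)
    simp only [cosetEnumerator_succ, Finset.sum_add_distrib, ← Finset.mul_sum]
    rw [Finset.sum_comm]
    simp only [h, ih, Finset.sum_const, Finset.card_univ, nsmul_eq_mul]
    ring

theorem one_sub_pow_le_cosetEnumerator_sub {K : Type*} [Field K] [Fintype K] [DecidableEq K]
    {n : ℕ} (a : Fin n → K) {z : ℝ} (hz : 0 ≤ z) (hz1 : z ≤ 1) {v : K} (hv : v ≠ 0) :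
    (1 - z) ^ n ≤ cosetEnumerator a z 0 - cosetEnumerator a z v := by
  induction n with
  | zero => simp [cosetEnumerator, hammingNorm, hv.symm]
  | succ n ih =>
    have hih := ih (Fin.tail a)
    have h1 : 0 ≤ 1 - z := by linarith
    have h0 : 0 ≤ (1 - z) ^ n := pow_nonneg h1 n
    rw [cosetEnumerator_succ, cosetEnumerator_succ]
    by_cases ha : a 0 = 0
    · simp only [ha, zero_mul, sub_zero, Finset.sum_const, Finset.card_univ, nsmul_eq_mul]
      have h2 : 0 ≤ z * Fintype.card K := by positivity
      rw [pow_succ]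
      nlinarith [mul_le_mul_of_nonneg_left hih h1, mul_le_mul_of_nonneg_left hih h2]
    · have h : ∀ u : K, ∑ y, cosetEnumerator (Fin.tail a) z (u - a 0 * y) =
          ∑ y, cosetEnumerator (Fin.tail a) z y := fun u =>
        ((Equiv.mulLeft₀ (a 0) ha).trans (Equiv.subLeft u)).sum_comp
          (cosetEnumerator (Fin.tail a) z)
      rw [h, h, pow_succ]
      nlinarith [mul_le_mul_of_nonneg_left hih h1]

theorem le_card_mul_cosetEnumerator_zero {K : Type*} [Field K] [Fintype K] [DecidableEq K]
    {n : ℕ} (a : Fin n → K) {z : ℝ} (hz : 0 ≤ z) (hz1 : z ≤ 1) :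
    (1 + ((Fintype.card K : ℝ) - 1) * z) ^ n + ((Fintype.card K : ℝ) - 1) * (1 - z) ^ n ≤
      Fintype.card K * cosetEnumerator a z 0 := by
  have h : ∑ v : K, (cosetEnumerator a z v + if v = 0 then 0 else (1 - z) ^ n) ≤
      ∑ _v : K, cosetEnumerator a z 0 := by
    refine Finset.sum_le_sum fun v _ => ?_
    split_ifs with hv
    · simp [hv]
    · linarith [one_sub_pow_le_cosetEnumerator_sub a hz hz1 hv]
  have h2 : ∀ v : K, (if v = 0 then 0 else (1 - z) ^ n) =
      (1 - z) ^ n - if v = 0 then (1 - z) ^ n else 0 := by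
    intro v; split_ifs <;> ring
  simp only [h2, Finset.sum_add_distrib, Finset.sum_sub_distrib, sum_cosetEnumerator,
    Finset.sum_const, Finset.card_univ, nsmul_eq_mul, Finset.sum_ite_eq', Finset.mem_univ,
    if_true] at h
  linarith

/-- Among codes of codimension one, the weight enumerator is smallest for a parity check of
full weight. -/
theorem le_card_mul_sum_pow_hammingNorm {K : Type*} [Field K] [Fintype K] [DecidableEq K]
    {n : ℕ} (hn : 1 ≤ n) (C : Submodule K (Fin n → K)) [Fintype C]
    (hC : Module.finrank K C = n - 1)
    {z : ℝ} (hz : 0 ≤ z) (hz1 : z ≤ 1) :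
    (1 + ((Fintype.card K : ℝ) - 1) * z) ^ n + ((Fintype.card K : ℝ) - 1) * (1 - z) ^ n ≤
      Fintype.card K * ∑ x : C, z ^ hammingNorm (x : Fin n → K) := by
  have hlt : C < ⊤ := by
    refine lt_top_iff_ne_top.2 fun h => ?_
    rw [h, finrank_top, Module.finrank_fin_fun] at hC
    omega
  obtain ⟨f, hf, hle⟩ := Submodule.exists_le_ker_of_lt_top C hlt
  have hker : C = LinearMap.ker f := by
    refine Submodule.eq_of_le_of_finrank_eq hle ?_
    have := Module.Dual.finrank_ker_add_one_of_ne_zero hf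
    rw [Module.finrank_fin_fun] at this
    omega
  have hmem : ∀ x, x ∈ C ↔ ∑ t, f (Pi.single t 1) * x t = 0 := by
    intro x
    rw [hker, LinearMap.mem_ker, LinearMap.pi_apply_eq_sum_univ f x]
    simp only [smul_eq_mul, mul_comm]
    have : ∀ t, (Pi.single t 1 : Fin n → K) = fun j => if t = j then 1 else 0 := by
      intro t; ext j; simp [Pi.single_apply, eq_comm]
    simp only [this]
  refine (le_card_mul_cosetEnumerator_zero (fun t => f (Pi.single t 1)) hz hz1).trans_eq ?_
  classical
  congr 1
  unfold cosetEnumerator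
  simp only [← hmem]
  rw [← Finset.sum_filter]
  exact Finset.sum_subtype _ (by simp) _

theorem one_le_enumerator {q : ℕ} (hq : 1 ≤ q) (n : ℕ) {z : ℝ} (hz : 0 ≤ z) (hz1 : z ≤ 1) :
    1 ≤ (1 + ((q : ℝ) - 1) * z) ^ n + ((q : ℝ) - 1) * (1 - z) ^ n := by
  have h1 : (0 : ℝ) ≤ (q : ℝ) - 1 := sub_nonneg.2 (by exact_mod_cast hq)
  have h2 : 1 ≤ (1 + ((q : ℝ) - 1) * z) ^ n :=
    one_le_pow₀ (by linarith [mul_nonneg h1 hz])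
  have h3 : 0 ≤ ((q : ℝ) - 1) * (1 - z) ^ n := mul_nonneg h1 (pow_nonneg (by linarith) n)
  linarith

theorem lambdaQ_le {q : ℕ} (hq : 2 ≤ q) {ω : ℝ} (hω : 0 ≤ ω) (n : ℕ) {z : ℝ} (hz : 0 < z)
    (hz1 : z ≤ 1) :
    lambdaQ q ω n ≤ -ω * Real.logb q z - 1 / n +
      (1 / n) * Real.logb q ((1 + ((q : ℝ) - 1) * z) ^ n + ((q : ℝ) - 1) * (1 - z) ^ n) := by
  have hq1 : (1 : ℝ) < q := by exact_mod_cast hq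
  refine ciInf_le (f := fun z : Ioc (0 : ℝ) 1 => -ω * Real.logb q (z : ℝ) - 1 / n +
    (1 / n) * Real.logb q ((1 + ((q : ℝ) - 1) * (z : ℝ)) ^ n + ((q : ℝ) - 1) * (1 - (z : ℝ)) ^ n))
    ⟨-(1 / n), ?_⟩ (⟨z, hz, hz1⟩ : Ioc (0 : ℝ) 1)
  rintro _ ⟨⟨y, hy, hy1⟩, rfl⟩
  have h1 : Real.logb q y ≤ 0 := Real.logb_nonpos hq1 hy.le hy1
  have h2 := Real.logb_nonneg hq1 (one_le_enumerator (by omega : 1 ≤ q) n hy.le hy1)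
  have h3 : 0 ≤ -ω * Real.logb q y := by nlinarith
  have h4 := mul_nonneg (by positivity : (0 : ℝ) ≤ 1 / n) h2
  simp only
  linarith

theorem lambdaQ_zero_nonpos {q : ℕ} (hq : 2 ≤ q) (n : ℕ) : lambdaQ q 0 n ≤ 0 := by
  have hq1 : (1 : ℝ) < q := by exact_mod_cast hq
  let g : ℝ → ℝ := fun z => -0 * Real.logb q z - 1 / n +
    (1 / n) * Real.logb q ((1 + ((q : ℝ) - 1) * z) ^ n + ((q : ℝ) - 1) * (1 - z) ^ n)
  have hg0 : g 0 = 0 := by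
    simp [g, Real.logb_self_eq_one hq1]
  have hg : ContinuousAt g 0 := by
    simp only [g, neg_zero, zero_mul, Real.logb]
    refine ContinuousAt.add continuousAt_const (continuousAt_const.mul (ContinuousAt.div_const ?_ _))
    refine ContinuousAt.log (by fun_prop) ?_
    simp
    linarith
  have ht : Tendsto g (nhdsWithin 0 (Ioi 0)) (nhds 0) := by
    have := hg.tendsto
    rw [hg0] at this
    exact this.mono_left nhdsWithin_le_nhds
  refine ge_of_tendsto ht ?_
  filter_upwards [Ioc_mem_nhdsGT (zero_lt_one' ℝ)] with z hz
  exact lambdaQ_le hq le_rfl n hz.1 hz.2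

/-- Concavity of `lambdaQ` in `ω`, comparing the infimum at `ω` with the objective at `τ * ω`. -/
theorem mul_lambdaQ_sub_le {q : ℕ} (hq : 2 ≤ q) {ω : ℝ} (hω : 0 ≤ ω) (n : ℕ) {z : ℝ}
    (hz : 0 < z) (hz1 : z ≤ 1) {τ : ℝ} (hτ : 0 ≤ τ) (hτ1 : τ ≤ 1) :
    τ * lambdaQ q ω n - (1 - τ) / n ≤ -(τ * ω) * Real.logb q z - 1 / n +
      (1 / n) * Real.logb q ((1 + ((q : ℝ) - 1) * z) ^ n + ((q : ℝ) - 1) * (1 - z) ^ n) := by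
  have hq1 : (1 : ℝ) < q := by exact_mod_cast hq
  have h1 := mul_le_mul_of_nonneg_left (lambdaQ_le hq hω n hz hz1) hτ
  have h2 := Real.logb_nonneg hq1 (one_le_enumerator (by omega : 1 ≤ q) n hz.le hz1)
  have h3 := mul_nonneg (by linarith : 0 ≤ 1 - τ)
    (mul_nonneg (by positivity : (0 : ℝ) ≤ 1 / n) h2)
  rw [div_eq_mul_one_div]
  linarith

/-- Exponential lower bound for the number of words of relative weight at most
`(1 + τ) / 2 * ω` in a product of `ℓ` codes of codimension one. -/
theorem logb_card_lightWords_ge {K : Type*} [Field K] [Fintype K] [DecidableEq K] {n : ℕ}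
    (hn : 1 ≤ n) {ℓ : ℕ} (hℓ : 1 ≤ ℓ) (C : Fin ℓ → Submodule K (Fin n → K))
    [∀ j, Fintype (C j)]
    (hC : ∀ j, Module.finrank K (C j) = n - 1) {ω : ℝ} (hω : 0 < ω) {τ : ℝ} (hτ : 0 ≤ τ)
    (hτ1 : τ < 1) (hℓτ : 2 ≤ ((1 - τ) / 4 * ω) ^ 2 * ℓ) :
    (ℓ * n : ℝ) * (τ * lambdaQ (Fintype.card K) ω n - (1 - τ) / n) -
        Real.logb (Fintype.card K) 2 ≤
      Real.logb (Fintype.card K) ((Finset.univ.filter fun c : ∀ j, C j =>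
        ((∑ j, hammingNorm (c j : Fin n → K) : ℕ) : ℝ) ≤ (1 + τ) / 2 * ω * (ℓ * n)).card : ℝ) := by
  set q := Fintype.card K with hq
  have hq2 : 2 ≤ q := Fintype.one_lt_card
  have hq1 : (1 : ℝ) < q := by exact_mod_cast hq2
  have hn0 : (0 : ℝ) < n := by exact_mod_cast hn
  have hℓ0 : (0 : ℝ) < ℓ := by exact_mod_cast hℓ
  have hN : (0 : ℝ) < ℓ * n := mul_pos hℓ0 hn0
  set w : ∀ j, C j → ℕ := fun j x => hammingNorm (x : Fin n → K) with hw
  have hwn : ∀ j x, w j x ≤ n := fun j x => by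
    simpa using hammingNorm_le_card_fintype (x := (x : Fin n → K))
  set η : ℝ := (1 - τ) / 4 * ω with hη
  have hη0 : 0 < η := mul_pos (by linarith) hω
  set s : ℝ := (1 + 3 * τ) / 4 * ω with hs
  have hs0 : 0 < s := mul_pos (by linarith) hω
  obtain ⟨z, hz, hz1, hle, hcase⟩ := exists_tiltedMean_eq w (fun _ => 0)
    (fun j => by simp [hw]) (mul_pos hs0 hN)
  have hT : 2 * ((Fintype.card (Fin ℓ) : ℝ) * (n : ℝ) ^ 2) ≤ (η * (ℓ * n)) ^ 2 := by
    rw [Fintype.card_fin]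
    calc 2 * ((ℓ : ℝ) * (n : ℝ) ^ 2) ≤ (η ^ 2 * ℓ) * (ℓ * (n : ℝ) ^ 2) :=
          mul_le_mul_of_nonneg_right hℓτ (by positivity)
      _ = _ := by ring
  have hmain := prod_sum_le_card_mul_rpow w n hwn hz hz1 (mul_pos hη0 hN) hT
  set M : ℝ := ((Finset.univ.filter fun c : ∀ j, C j =>
    ((∑ j, hammingNorm (c j : Fin n → K) : ℕ) : ℝ) ≤ (1 + τ) / 2 * ω * (ℓ * n)).card : ℝ) with hM
  set F : ℝ := (1 + ((q : ℝ) - 1) * z) ^ n + ((q : ℝ) - 1) * (1 - z) ^ n with hF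
  have hF0 : 0 < F :=
    one_pos.trans_le (one_le_enumerator (by omega : 1 ≤ q) n hz.le hz1)
  have hexp : z ^ (tiltedMean w z - η * (ℓ * n)) = z ^ (τ * ω * (ℓ * n)) := by
    rcases hcase with h | h
    · rw [h]; congr 1; rw [hs, hη]; ring
    · rw [h, Real.one_rpow, Real.one_rpow]
  have hcard : (((Finset.univ.filter fun c : ∀ j, C j =>
      ((∑ j, w j (c j) : ℕ) : ℝ) ≤ tiltedMean w z + η * (ℓ * n)).card : ℕ) : ℝ) ≤ M := by
    rw [hM]
    refine Nat.cast_le.2 (Finset.card_le_card ?_)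
    refine Finset.monotone_filter_right _ fun c _ hc => ?_
    refine hc.trans ?_
    have : s * (ℓ * n) + η * (ℓ * n) = (1 + τ) / 2 * ω * (ℓ * n) := by rw [hs, hη]; ring
    linarith
  have hprod : (F / q) ^ ℓ ≤ ∏ j, ∑ x : C j, z ^ w j x := by
    have : ∏ _j : Fin ℓ, F / q ≤ ∏ j, ∑ x : C j, z ^ w j x := by
      refine Finset.prod_le_prod (fun _ _ => by positivity) fun j _ => ?_
      rw [div_le_iff₀' (by linarith)]
      exact le_card_mul_sum_pow_hammingNorm hn (C j) (hC j) hz.le hz1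
    rwa [Finset.prod_const, Finset.card_univ, Fintype.card_fin] at this
  have hzpos : 0 < z ^ (τ * ω * (ℓ * n)) := Real.rpow_pos_of_pos hz _
  have hfin : (F / q) ^ ℓ / 2 ≤ M * z ^ (τ * ω * (ℓ * n)) := by
    rw [hexp] at hmain
    have := mul_le_mul_of_nonneg_right hcard hzpos.le
    linarith
  have hFq : 0 < F / q := div_pos hF0 (by linarith)
  have hM0 : 0 < M := by
    have : 0 < M * z ^ (τ * ω * (ℓ * n)) := lt_of_lt_of_le (by positivity) hfin
    exact pos_of_mul_pos_left this hzpos.le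
  have hlog := Real.logb_le_logb_of_le hq1 (by positivity) hfin
  rw [Real.logb_div (by positivity) (by norm_num), Real.logb_pow,
    Real.logb_div hF0.ne' (by positivity), Real.logb_self_eq_one hq1,
    Real.logb_mul hM0.ne' hzpos.ne', Real.logb_rpow_eq_mul_logb_of_pos hz] at hlog
  have hscale := mul_le_mul_of_nonneg_left
    (mul_lambdaQ_sub_le hq2 hω.le n hz hz1 hτ hτ1.le) hN.le
  have hring : (ℓ * n : ℝ) * (-(τ * ω) * Real.logb q z - 1 / n + (1 / n) * Real.logb q F) =
      ℓ * (Real.logb q F - 1) - τ * ω * (ℓ * n) * Real.logb q z := by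
    field_simp
    ring
  rw [← hF, hring] at hscale
  linarith

theorem hammingNorm_uncurry {K : Type*} [Zero K] [DecidableEq K] {ℓ n : ℕ}
    (x : Fin ℓ × Fin n → K) : hammingNorm x = ∑ j, hammingNorm fun t => x (j, t) := by
  simp only [hammingNorm, Finset.card_filter, Fintype.sum_prod_type]

/-- Lemma (equal constituent lengths): if `(A_i)` is a sequence of linear codes over `F`
of strictly increasing lengths `N_i = ℓ_i·n`, each a Cartesian product of `ℓ_i` linear
`[n, n-1]` codes of length exactly `n`, then for any nonnegative reals `ω_i` with
`liminf_i ω_i = ω`, one has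
`limsup_i (1/N_i)·log_q(|A_i| / |A_i(ω_i)|) ≤ R_0(ω,n)`. -/
theorem lemma_lambda
    (K : Type) [Field K] [Fintype K] [DecidableEq K]
    (q : ℕ) (hq : Fintype.card K = q)
    (n : ℕ) (hn : 1 ≤ n)
    -- the constituent codes: `ℓ i` of them in `A i`, each of length exactly `n`
    (ℓ : ℕ → ℕ)
    (Cc : ∀ (i : ℕ) (j : Fin (ℓ i)), Submodule K (Fin n → K))
    (hdim : ∀ i j, Module.finrank K (Cc i j) = n - 1)
    -- the lengths, strictly increasing
    (N : ℕ → ℕ) (hN : ∀ i, N i = ℓ i * n)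
    (hmono : StrictMono N)
    -- `A i` is the Cartesian product of the constituent codes
    (A : ∀ i : ℕ, Set (Fin (ℓ i) × Fin n → K))
    (hA : ∀ i, A i = {x | ∀ j : Fin (ℓ i), (fun t => x (j, t)) ∈ Cc i j})
    -- the weight fractions
    (ωs : ℕ → ℝ) (hωs : ∀ i, 0 ≤ ωs i)
    (ω : ℝ) (hω : liminf ωs atTop = ω) :
    limsup (fun i =>
        Real.logb q (((A i).ncard : ℝ) /
          (({c ∈ A i | (hammingNorm c : ℝ) ≤ ωs i * (N i : ℝ)}).ncard : ℝ)) / (N i : ℝ))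
      atTop ≤ R0 q ω n := by
  classical
  subst hq
  set q := Fintype.card K with hq
  have hq2 : 2 ≤ q := Fintype.one_lt_card
  have hq1 : (1 : ℝ) < q := by exact_mod_cast hq2
  have hn0 : (0 : ℝ) < n := by exact_mod_cast hn
  have hNtop : Tendsto (fun i => (N i : ℝ)) atTop atTop :=
    tendsto_natCast_atTop_atTop.comp hmono.tendsto_atTop
  have hNℓ : ∀ i, (N i : ℝ) = ℓ i * n := fun i => by rw [hN]; push_cast; rfl
  let Φ : ∀ i, (∀ j, Cc i j) → (Fin (ℓ i) × Fin n → K) := fun i c p => (c p.1 : Fin n → K) p.2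
  have hΦ : ∀ i, Function.Injective (Φ i) := by
    intro i c d h
    funext j
    ext t
    exact congrFun h (j, t)
  have hlight : ∀ i (r : ℝ), {c ∈ A i | (hammingNorm c : ℝ) ≤ r}.ncard =
      (Finset.univ.filter fun c : ∀ j, Cc i j =>
        ((∑ j, hammingNorm (c j : Fin n → K) : ℕ) : ℝ) ≤ r).card := by
    intro i r
    rw [← Set.ncard_coe_finset, ← Set.ncard_image_of_injective _ (hΦ i)]
    congr 1
    ext x
    simp only [hA, mem_ofPred_eq, mem_image, Finset.coe_filter, Finset.mem_univ, true_and]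
    constructor
    · rintro ⟨hx, hr⟩
      refine ⟨fun j => ⟨fun t => x (j, t), hx j⟩, ?_, rfl⟩
      rwa [hammingNorm_uncurry] at hr
    · rintro ⟨c, hr, rfl⟩
      refine ⟨fun j => (c j).2, ?_⟩
      rwa [hammingNorm_uncurry]
  have hcardA : ∀ i, ((A i).ncard : ℝ) = (q : ℝ) ^ ((n - 1) * ℓ i) := by
    intro i
    have h1 : A i = range (Φ i) := by
      ext x
      simp only [hA, mem_ofPred_eq, mem_range]
      constructor
      · exact fun hx => ⟨fun j => ⟨fun t => x (j, t), hx j⟩, rfl⟩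
      · rintro ⟨c, rfl⟩
        exact fun j => (c j).2
    have hcard : ∀ j, Fintype.card (Cc i j) = q ^ (n - 1) := fun j => by
      rw [Module.card_eq_pow_finrank (K := K), hdim]
    have h2 : (A i).ncard = q ^ ((n - 1) * ℓ i) := by
      rw [h1, ← image_univ, Set.ncard_image_of_injective _ (hΦ i), Set.ncard_univ,
        Nat.card_eq_fintype_card, Fintype.card_pi]
      simp only [hcard, Finset.prod_const, Finset.card_univ, Fintype.card_fin, pow_mul]
    exact_mod_cast h2
  have hfin : ∀ i, (A i).Finite := fun i => Set.toFinite _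
  set B : ℕ → ℝ := fun i =>
    (({c ∈ A i | (hammingNorm c : ℝ) ≤ ωs i * (N i : ℝ)}).ncard : ℝ) with hBdef
  have hB1 : ∀ i, 1 ≤ B i := by
    intro i
    have : 0 < ({c ∈ A i | (hammingNorm c : ℝ) ≤ ωs i * (N i : ℝ)}).ncard := by
      rw [Set.ncard_pos ((hfin i).subset (sep_subset _ _))]
      refine ⟨0, ?_, ?_⟩
      · rw [hA]
        exact fun j => (Cc i j).zero_mem
      · simpa using mul_nonneg (hωs i) (Nat.cast_nonneg (N i))
    exact Nat.one_le_cast.2 this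
  have hBA : ∀ i, B i ≤ (A i).ncard := fun i =>
    Nat.cast_le.2 (Set.ncard_le_ncard (sep_subset _ _) (hfin i))
  have hsplit : ∀ i, Real.logb q ((A i).ncard / B i) = ((n : ℝ) - 1) * ℓ i - Real.logb q (B i) := by
    intro i
    have hB0 : B i ≠ 0 := (one_pos.trans_le (hB1 i)).ne'
    rw [hcardA, Real.logb_div (by positivity) hB0, Real.logb_pow, Real.logb_self_eq_one hq1,
      mul_one, Nat.cast_mul, Nat.cast_sub hn, Nat.cast_one]
  have hnonneg : ∀ i, 0 ≤ Real.logb q ((A i).ncard / B i) / N i := fun i =>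
    div_nonneg (Real.logb_nonneg hq1
      ((one_le_div (one_pos.trans_le (hB1 i))).2 (hBA i))) (Nat.cast_nonneg _)
  have hcob : IsCoboundedUnder (· ≤ ·) atTop
      (fun i => Real.logb q ((A i).ncard / B i) / (N i : ℝ)) :=
    (isBoundedUnder_of ⟨0, hnonneg⟩ : IsBoundedUnder (· ≥ ·) atTop _).isCoboundedUnder_le
  have hrate : ∀ i, ((n : ℝ) - 1) * ℓ i = ((n : ℝ) - 1) / n * N i := by
    intro i
    rw [hNℓ]
    field_simp
  have hωbdd : IsBoundedUnder (· ≥ ·) atTop ωs := isBoundedUnder_of ⟨0, hωs⟩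
  have hω0 : 0 ≤ ω := by
    rw [← hω, liminf_eq]
    by_cases hb : BddAbove {a | ∀ᶠ i in atTop, a ≤ ωs i}
    · exact le_csSup hb (Eventually.of_forall hωs)
    · rw [Real.sSup_of_not_bddAbove hb]
  unfold R0
  rcases hω0.eq_or_lt with h0 | hωpos
  · have hlam := lambdaQ_zero_nonpos hq2 n
    rw [← h0]
    refine limsup_le_of_le hcob ?_
    filter_upwards [hNtop.eventually_gt_atTop 0] with i hi
    have hlog := Real.logb_nonneg hq1 (hB1 i)
    rw [div_le_iff₀ hi, hsplit, hrate]
    nlinarith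
  refine le_of_forall_pos_le_add fun ε hε => limsup_le_of_le hcob ?_
  set L := lambdaQ q ω n with hL
  obtain ⟨τ, hτ, hτ1, hτε⟩ : ∃ τ : ℝ, 0 ≤ τ ∧ τ < 1 ∧ (1 - τ) * (L + 1 / n) ≤ ε / 2 := by
    have ht : Tendsto (fun τ : ℝ => (1 - τ) * (L + 1 / n)) (nhdsWithin 1 (Iio 1)) (nhds 0) := by
      have : Continuous fun τ : ℝ => (1 - τ) * (L + 1 / n) := by fun_prop
      have h := this.tendsto 1
      rw [sub_self, zero_mul] at h
      exact h.mono_left nhdsWithin_le_nhds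
    obtain ⟨τ, h1, h2⟩ := ((ht.eventually_le_const (half_pos hε)).and
      (Ico_mem_nhdsLT (zero_lt_one' ℝ))).exists
    exact ⟨τ, h2.1, h2.2, h1⟩
  have hev : ∀ᶠ i in atTop, (1 + τ) / 2 * ω < ωs i := by
    refine eventually_lt_of_lt_liminf ?_ hωbdd
    rw [hω]
    nlinarith
  have hη : 0 < ((1 - τ) / 4 * ω) ^ 2 := by
    have : 0 < 1 - τ := by linarith
    positivity
  filter_upwards [hev, hNtop.eventually_gt_atTop 0,
    hNtop.eventually_ge_atTop (2 / ((1 - τ) / 4 * ω) ^ 2 * n),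
    hNtop.eventually_ge_atTop (Real.logb q 2 / (ε / 2))] with i hωi hi hi2 hi3
  have hℓ : 1 ≤ ℓ i := by
    rcases Nat.eq_zero_or_pos (ℓ i) with h | h
    · rw [hNℓ, h] at hi
      simp at hi
    · exact h
  have hℓτ : 2 ≤ ((1 - τ) / 4 * ω) ^ 2 * ℓ i := by
    rw [hNℓ] at hi2
    have := le_of_mul_le_mul_right hi2 hn0
    rwa [div_le_iff₀' hη] at this
  have hlow := logb_card_lightWords_ge hn hℓ (Cc i) (hdim i) hωpos hτ hτ1 hℓτ
  rw [← hlight, ← hNℓ, ← hq, ← hL] at hlow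
  have hmonoB : Real.logb q ({c ∈ A i | (hammingNorm c : ℝ) ≤ (1 + τ) / 2 * ω * N i}.ncard : ℝ) ≤
      Real.logb q (B i) := by
    have hsub : {c ∈ A i | (hammingNorm c : ℝ) ≤ (1 + τ) / 2 * ω * N i} ⊆
        {c ∈ A i | (hammingNorm c : ℝ) ≤ ωs i * (N i : ℝ)} := fun c hc =>
      ⟨hc.1, hc.2.trans (mul_le_mul_of_nonneg_right hωi.le hi.le)⟩
    refine Real.logb_le_logb_of_le hq1 ?_
      (Nat.cast_le.2 (Set.ncard_le_ncard hsub ((hfin i).subset (sep_subset _ _))))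
    refine Nat.cast_pos.2 ((Set.ncard_pos ((hfin i).subset (sep_subset _ _))).2 ⟨0, ?_, ?_⟩)
    · rw [hA]
      exact fun j => (Cc i j).zero_mem
    · have : 0 ≤ (1 + τ) / 2 * ω * N i := by positivity
      simpa using this
  rw [div_le_iff₀ hi, hsplit, hrate]
  rw [div_le_iff₀' (half_pos hε)] at hi3
  have hτN := mul_le_mul_of_nonneg_left hτε hi.le
  have hring : (N i : ℝ) * ((1 - τ) * (L + 1 / n)) =
      N i * L - N i * (τ * L - (1 - τ) / n) := by ring
  rw [hring] at hτN
  linarith
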